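/- The flat Thomas-D operator is null: as an operator identity on smooth functions on ℝ^{n+2}, η^{AB} D_A D_B = X² □², i.e. D_A D^A f = X² □(□ f) for every smooth f. -/

import Mathlib

noncomputable section

/-- Partial derivative in coordinate direction `A` of a function on `ℝ^m`. -/
def pd {m : ℕ} (A : Fin m) (f : (Fin m → ℝ) → ℝ) : (Fin m → ℝ) → ℝ :=
  fun x => fderiv ℝ f x (Pi.single A 1)

/-- The Euler operator `X·∂`. -/
def euler {m : ℕ} (f : (Fin m → ℝ) → ℝ) : (Fin m → ℝ) → ℝ :=
  fun x => ∑ A, x A * pd A f x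

/-- The Laplacian `□ = η^{AB} ∂_A ∂_B` for the diagonal metric with entries `ε`. -/
def lap {m : ℕ} (ε : Fin m → ℝ) (f : (Fin m → ℝ) → ℝ) : (Fin m → ℝ) → ℝ :=
  fun x => ∑ A, ε A * pd A (pd A f) x

/-- `X² = η_{AB} X^A X^B` for the diagonal metric with entries `ε`. -/
def xsq {m : ℕ} (ε : Fin m → ℝ) (x : Fin m → ℝ) : ℝ :=
  ∑ A, ε A * x A ^ 2

/-- `ε` is a diagonal metric with all entries `±1` and exactly `q` entries equal to `-1`,
i.e. a nondegenerate symmetric bilinear form of signature `(m - q, q)`. -/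
def isSig {m : ℕ} (ε : Fin m → ℝ) (q : ℕ) : Prop :=
  (∀ A, ε A = 1 ∨ ε A = -1) ∧ Nat.card {A : Fin m // ε A = -1} = q

/-- The flat Thomas-D operator `D_A = 2(X·∂ + c)∂_A - X_A □` (with `c = n/2`). -/
def thomasD {m : ℕ} (ε : Fin m → ℝ) (c : ℝ) (A : Fin m) (f : (Fin m → ℝ) → ℝ) :
    (Fin m → ℝ) → ℝ :=
  fun x => 2 * (euler (pd A f) x + c * pd A f x) - ε A * x A * lap ε f x

/-! ### The identity in an algebra satisfying the canonical commutation relations -/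

section Weyl

variable {R : Type*} [Ring R] {m : ℕ} {P M : Fin m → R}

/-- The Euler element `∑ M_A P_A`. -/
def weylEuler (P M : Fin m → R) : R := ∑ A, M A * P A

theorem mul_weylEuler (hP : ∀ A B, P A * P B = P B * P A)
    (hPM : ∀ A B, P A * M B = M B * P A + if A = B then 1 else 0) (B : Fin m) :
    P B * weylEuler P M = weylEuler P M * P B + P B := by
  have h (A : Fin m) : P B * (M A * P A) = M A * P A * P B + if B = A then P A else 0 := by
    rw [← mul_assoc, hPM, add_mul, mul_assoc, hP B A, ← mul_assoc, ite_mul, one_mul, zero_mul]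
  simp [weylEuler, Finset.mul_sum, Finset.sum_mul, h, Finset.sum_add_distrib]

variable [Algebra ℝ R] {ε : Fin m → ℝ}

/-- The Laplacian element `∑ ε_A P_A P_A`. -/
def weylLap (ε : Fin m → ℝ) (P : Fin m → R) : R := ∑ A, ε A • (P A * P A)

/-- The Thomas-D element `2 (E + c) P_A - ε_A M_A L`. -/
def weylThomasD (ε : Fin m → ℝ) (c : ℝ) (P M : Fin m → R) (A : Fin m) : R :=
  (2 : ℝ) • (weylEuler P M * P A + c • P A) - ε A • (M A * weylLap ε P)

theorem mul_weylLap (hP : ∀ A B, P A * P B = P B * P A) (B : Fin m) :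
    P B * weylLap ε P = weylLap ε P * P B := by
  simp only [weylLap, Finset.mul_sum, Finset.sum_mul, mul_smul_comm, smul_mul_assoc]
  refine Finset.sum_congr rfl fun A _ => ?_
  rw [← mul_assoc, hP B A, mul_assoc, hP B A, mul_assoc]

theorem weylLap_mul (hPM : ∀ A B, P A * M B = M B * P A + if A = B then 1 else 0) (B : Fin m) :
    weylLap ε P * M B = M B * weylLap ε P + (2 * ε B) • P B := by
  have h (A : Fin m) : ε A • (P A * P A) * M B
      = M B * (ε A • (P A * P A)) + if A = B then (2 * ε A) • P A else 0 := by
    rw [smul_mul_assoc, mul_assoc, hPM, mul_add, ← mul_assoc, hPM]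
    split_ifs <;> simp only [add_mul, mul_smul_comm, mul_assoc, one_mul, mul_one,
      mul_zero, add_zero]
    module
  simp only [weylLap, Finset.mul_sum, Finset.sum_mul, h, Finset.sum_add_distrib]
  simp

theorem weylLap_mul_weylEuler (hP : ∀ A B, P A * P B = P B * P A)
    (hPM : ∀ A B, P A * M B = M B * P A + if A = B then 1 else 0) :
    weylLap ε P * weylEuler P M = weylEuler P M * weylLap ε P + (2 : ℝ) • weylLap ε P := by
  have h (A : Fin m) : ε A • (P A * P A) * weylEuler P M
      = weylEuler P M * (ε A • (P A * P A)) + (2 : ℝ) • ε A • (P A * P A) := by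
    rw [smul_mul_assoc, mul_assoc, mul_weylEuler hP hPM, mul_add, ← mul_assoc,
      mul_weylEuler hP hPM, add_mul, mul_smul_comm, mul_assoc]
    module
  rw [weylLap, Finset.sum_mul, Finset.mul_sum, Finset.smul_sum, ← Finset.sum_add_distrib]
  exact Finset.sum_congr rfl fun A _ => h A

theorem sum_mul_eq_weylEuler_add
    (hPM : ∀ A B, P A * M B = M B * P A + if A = B then 1 else 0) :
    ∑ A, P A * M A = weylEuler P M + (m : ℝ) • 1 := by
  simp [hPM, weylEuler, Finset.sum_add_distrib, Nat.cast_smul_eq_nsmul]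

theorem weylThomasD_null (hε : ∀ A, ε A * ε A = 1) {c : ℝ} (hc : (m : ℝ) = 2 * c + 2)
    (hP : ∀ A B, P A * P B = P B * P A)
    (hPM : ∀ A B, P A * M B = M B * P A + if A = B then 1 else 0) :
    ∑ A, ε A • (weylThomasD ε c P M A * weylThomasD ε c P M A)
      = (∑ A, ε A • (M A * M A)) * (weylLap ε P * weylLap ε P) := by
  set E := weylEuler P M with hE
  set L := weylLap ε P with hL
  have key (A : Fin m) : ε A • (weylThomasD ε c P M A * weylThomasD ε c P M A)
      = (4 : ℝ) • ((E + c • 1) * (E + (c + 1) • 1) * (ε A • (P A * P A)))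
        - (2 : ℝ) • ((E + c • 1) * (P A * M A) * L)
        - (2 : ℝ) • (M A * P A * (E + (c + 1) • 1) * L)
        + ε A • (M A * M A) * (L * L) + (2 : ℝ) • (M A * P A * L) := by
    have h1 : weylThomasD ε c P M A = (2 : ℝ) • ((E + c • 1) * P A) - ε A • (M A * L) := by
      simp [weylThomasD, add_mul, hE, hL]
    have h2 : P A * (E + c • 1) = (E + (c + 1) • 1) * P A := by
      rw [mul_add, mul_weylEuler hP hPM]
      simp only [add_mul, mul_smul_comm, smul_mul_assoc, one_mul, mul_one]
      module
    have h3 : L * (E + c • 1) * P A = P A * (E + (c + 1) • 1) * L := by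
      have : L * (E + c • 1) = (E + (c + 2) • 1) * L := by
        rw [mul_add, weylLap_mul_weylEuler hP hPM]
        simp only [add_mul, mul_smul_comm, smul_mul_assoc, one_mul, mul_one]
        module
      rw [this, mul_assoc, ← mul_weylLap hP, ← mul_assoc]
      congr 1
      rw [mul_add, mul_weylEuler hP hPM]
      simp only [add_mul, mul_smul_comm, smul_mul_assoc, one_mul, mul_one]
      module
    have h4 : L * M A = M A * L + (2 * ε A) • P A := weylLap_mul hPM A
    have e1 : (E + c • 1) * P A * ((E + c • 1) * P A)
        = (E + c • 1) * (E + (c + 1) • 1) * (P A * P A) := by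
      rw [mul_assoc, ← mul_assoc (P A), h2]; simp only [mul_assoc]
    have e2 : (E + c • 1) * P A * (M A * L) = (E + c • 1) * (P A * M A) * L := by
      simp only [mul_assoc]
    have e3 : M A * L * ((E + c • 1) * P A) = M A * P A * (E + (c + 1) • 1) * L := by
      rw [mul_assoc, ← mul_assoc L, h3]; simp only [mul_assoc]
    have e4 : M A * L * (M A * L) = M A * M A * (L * L) + (2 * ε A) • (M A * P A * L) := by
      rw [mul_assoc, ← mul_assoc L, h4]
      simp only [add_mul, mul_add, mul_assoc, smul_mul_assoc, mul_smul_comm]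
    rw [h1]
    simp only [sub_mul, mul_sub, smul_mul_assoc, mul_smul_comm, e1, e2, e3, e4]
    have := hε A
    match_scalars <;> grind
  simp only [key, Finset.sum_add_distrib, Finset.sum_sub_distrib, ← Finset.smul_sum,
    ← Finset.mul_sum, ← Finset.sum_mul, sum_mul_eq_weylEuler_add hPM]
  change (4 : ℝ) • ((E + c • 1) * (E + (c + 1) • 1) * L) - _
    - (2 : ℝ) • (E * (E + (c + 1) • 1) * L) + _ + (2 : ℝ) • (E * L) = _
  rw [hc, ← hE]
  simp only [add_mul, mul_add, smul_mul_assoc, mul_smul_comm, one_mul, mul_one]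
  module

end Weyl

/-! ### Smooth functions as a module over the Weyl algebra -/

section Smooth

variable {m : ℕ}

/-- The space of smooth functions on `ℝ^m`. -/
def smoothFun (m : ℕ) : Submodule ℝ ((Fin m → ℝ) → ℝ) where
  carrier := {f | ContDiff ℝ (⊤ : ℕ∞) f}
  add_mem' {f g} (hf : ContDiff ℝ (⊤ : ℕ∞) f) (hg : ContDiff ℝ (⊤ : ℕ∞) g) := hf.add hg
  zero_mem' := contDiff_const (𝕜 := ℝ) (n := (⊤ : ℕ∞)) (c := (0 : ℝ))
  smul_mem' a f (hf : ContDiff ℝ (⊤ : ℕ∞) f) := contDiff_const.mul (g := f) (f := fun _ => a) hf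

theorem smoothFun_contDiff (f : smoothFun m) : ContDiff ℝ (⊤ : ℕ∞) (f : (Fin m → ℝ) → ℝ) :=
  f.2

theorem smoothFun_differentiable (f : smoothFun m) : Differentiable ℝ (f : (Fin m → ℝ) → ℝ) :=
  (smoothFun_contDiff f).differentiable (by simp)

theorem contDiff_pd {f : (Fin m → ℝ) → ℝ} (hf : ContDiff ℝ (⊤ : ℕ∞) f) (A : Fin m) :
    ContDiff ℝ (⊤ : ℕ∞) (pd A f) :=
  (hf.fderiv_right (m := (⊤ : ℕ∞)) (by simp)).clm_apply contDiff_const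

theorem pd_comm {f : (Fin m → ℝ) → ℝ} (hf : ContDiff ℝ (⊤ : ℕ∞) f) (A B : Fin m) :
    pd A (pd B f) = pd B (pd A f) := by
  have hd : Differentiable ℝ (fderiv ℝ f) :=
    (hf.fderiv_right (m := (⊤ : ℕ∞)) (by simp)).differentiable (by simp)
  have h (A B : Fin m) (x : Fin m → ℝ) :
      pd A (pd B f) x = fderiv ℝ (fderiv ℝ f) x (Pi.single A 1) (Pi.single B 1) := by
    unfold pd
    rw [fderiv_clm_apply (hd x) (differentiableAt_const _)]
    simp
  funext x
  rw [h, h]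
  exact (hf.contDiffAt.isSymmSndFDerivAt (by
    simpa using WithTop.coe_le_coe.2 (le_top : (2 : ℕ∞) ≤ ⊤))).eq _ _

/-- Partial differentiation as an endomorphism of the space of smooth functions. -/
def pdEnd (A : Fin m) : Module.End ℝ (smoothFun m) where
  toFun f := ⟨pd A f, contDiff_pd f.2 A⟩
  map_add' f g := by
    ext x
    simp [pd, fderiv_add (smoothFun_differentiable f x) (smoothFun_differentiable g x)]
  map_smul' a f := by
    ext x
    simp [pd, fderiv_const_smul (smoothFun_differentiable f x)]

/-- Multiplication by a coordinate as an endomorphism of the space of smooth functions. -/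
def coordEnd (A : Fin m) : Module.End ℝ (smoothFun m) where
  toFun f := ⟨fun x => x A * (f : (Fin m → ℝ) → ℝ) x,
    (contDiff_apply ℝ ℝ A).mul (smoothFun_contDiff f)⟩
  map_add' f g := by
    ext x
    simp [mul_add]
  map_smul' a f := by
    ext x
    simp [mul_left_comm]

@[simp] theorem coe_pdEnd (A : Fin m) (f : smoothFun m) :
    (pdEnd A f : (Fin m → ℝ) → ℝ) = pd A f := rfl

@[simp] theorem coordEnd_apply (A : Fin m) (f : smoothFun m) (x : Fin m → ℝ) :
    (coordEnd A f : (Fin m → ℝ) → ℝ) x = x A * (f : (Fin m → ℝ) → ℝ) x := rfl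

theorem pdEnd_comm (A B : Fin m) : pdEnd A * pdEnd B = pdEnd B * pdEnd A := by
  ext f : 2
  exact pd_comm f.2 A B

theorem pdEnd_mul_coordEnd (A B : Fin m) :
    pdEnd A * coordEnd B = coordEnd B * pdEnd A + if A = B then 1 else 0 := by
  ext f x
  have h : pd A (fun y => y B * (f : (Fin m → ℝ) → ℝ) y) x
      = x B * pd A f x + (if A = B then 1 else 0) * (f : (Fin m → ℝ) → ℝ) x := by
    have hB : HasFDerivAt (fun y : Fin m → ℝ => y B)
        (ContinuousLinearMap.proj (R := ℝ) (φ := fun _ : Fin m => ℝ) B) x :=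
      (ContinuousLinearMap.proj (R := ℝ) (φ := fun _ : Fin m => ℝ) B).hasFDerivAt
    unfold pd
    rw [(hB.fun_mul (smoothFun_differentiable f x).hasFDerivAt).fderiv]
    simp [Pi.single_apply, eq_comm, mul_comm]
  refine h.trans ?_
  split_ifs <;> simp

theorem coe_weylEuler (f : smoothFun m) :
    (weylEuler pdEnd coordEnd f : (Fin m → ℝ) → ℝ) = euler f := by
  ext x
  simp [weylEuler, euler]

theorem coe_weylLap (ε : Fin m → ℝ) (f : smoothFun m) :
    (weylLap ε pdEnd f : (Fin m → ℝ) → ℝ) = lap ε f := by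
  ext x
  simp [weylLap, lap]

theorem coe_weylThomasD (ε : Fin m → ℝ) (c : ℝ) (A : Fin m) (f : smoothFun m) :
    (weylThomasD ε c pdEnd coordEnd A f : (Fin m → ℝ) → ℝ) = thomasD ε c A f := by
  ext x
  simp [weylThomasD, thomasD, coe_weylEuler, coe_weylLap, mul_assoc, mul_add]

end Smooth

/-- the flat Thomas-D operator is null: `η^{AB} D_A D_B f = X² □(□ f)`
for every smooth `f` on `ℝ^{n+2}`. -/
theorem thomasD_null
    (n : ℕ) (hn : 1 ≤ n) (ε : Fin (n + 2) → ℝ) (hsig : isSig ε 2)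
    (f : (Fin (n + 2) → ℝ) → ℝ) (hf : ContDiff ℝ (⊤ : ℕ∞) f) :
    ∀ x : Fin (n + 2) → ℝ,
      ∑ A, ε A * thomasD ε ((n : ℝ) / 2) A (thomasD ε ((n : ℝ) / 2) A f) x
        = xsq ε x * lap ε (lap ε f) x := by
  intro x
  have hε (A : Fin (n + 2)) : ε A * ε A = 1 := by
    rcases hsig.1 A with h | h <;> simp [h]
  have hc : ((n + 2 : ℕ) : ℝ) = 2 * ((n : ℝ) / 2) + 2 := by
    push_cast
    ring
  let F : smoothFun (n + 2) := ⟨f, hf⟩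
  have h := congrArg (fun T : Module.End ℝ (smoothFun (n + 2)) => (T F : (Fin (n + 2) → ℝ) → ℝ) x)
    (weylThomasD_null hε hc pdEnd_comm pdEnd_mul_coordEnd)
  simpa [F, coe_weylThomasD, coe_weylLap, xsq, Finset.sum_mul, sq, mul_assoc] using h

end
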